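/- The function x(γ) = (exp(γ)*(γ-1) + 1)/(exp(γ)-1)^2 is strictly monotone decreasing on γ ∈ (0, ∞). -/

import Mathlib

theorem Real.exp_mul_one_sub_lt_one {x : ℝ} (hx : x ≠ 0) : Real.exp x * (1 - x) < 1 := by
  have h := Real.add_one_lt_exp (neg_ne_zero.mpr hx)
  calc Real.exp x * (1 - x) < Real.exp x * Real.exp (-x) :=
        mul_lt_mul_of_pos_left (by linarith) (Real.exp_pos x)
    _ = 1 := by rw [← Real.exp_add, add_neg_cancel, Real.exp_zero]

theorem Real.exp_mul_two_sub_lt_two_add {x : ℝ} (hx : 0 < x) :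
    Real.exp x * (2 - x) < 2 + x := by
  have hd (y : ℝ) : HasDerivAt (fun y : ℝ => Real.exp y * (2 - y) - (2 + y))
      (Real.exp y * (1 - y) - 1) y := by
    refine (((Real.hasDerivAt_exp y).mul ((hasDerivAt_id y).const_sub 2)).sub
      ((hasDerivAt_id y).const_add 2)).congr_deriv ?_
    simp only [id]
    ring
  have hanti : StrictAntiOn (fun y : ℝ => Real.exp y * (2 - y) - (2 + y)) (Set.Ici 0) := by
    refine strictAntiOn_of_deriv_neg (convex_Ici 0) (by fun_prop) fun y hy => ?_
    rw [interior_Ici] at hy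
    rw [(hd y).deriv]
    linarith [Real.exp_mul_one_sub_lt_one (ne_of_gt (Set.mem_Ioi.mp hy))]
  have h := hanti Set.self_mem_Ici hx.le hx
  norm_num at h
  exact h

theorem stmt_3 :
    StrictAntiOn (fun γ : ℝ => (Real.exp γ * (γ - 1) + 1) / (Real.exp γ - 1) ^ 2)
      (Set.Ioi (0 : ℝ)) := by
  have hpos {x : ℝ} (hx : 0 < x) : 0 < Real.exp x - 1 := sub_pos.mpr (Real.one_lt_exp_iff.mpr hx)
  have hd {x : ℝ} (hx : 0 < x) :
      HasDerivAt (fun γ : ℝ => (Real.exp γ * (γ - 1) + 1) / (Real.exp γ - 1) ^ 2)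
        (Real.exp x * (Real.exp x * (2 - x) - (2 + x)) / (Real.exp x - 1) ^ 3) x := by
    have hne := (hpos hx).ne'
    refine ((((Real.hasDerivAt_exp x).mul ((hasDerivAt_id x).sub_const 1)).add_const 1).div
      (((Real.hasDerivAt_exp x).sub_const 1).pow 2) (pow_ne_zero 2 hne)).congr_deriv ?_
    simp only [id, Pi.mul_apply, Pi.pow_apply]
    field_simp
    ring
  refine strictAntiOn_of_deriv_neg (convex_Ioi 0)
    (fun x hx => (hd hx).continuousAt.continuousWithinAt) fun x hx => ?_
  rw [interior_Ioi] at hx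
  rw [(hd hx).deriv]
  exact div_neg_of_neg_of_pos
    (mul_neg_of_pos_of_neg (Real.exp_pos x) (sub_neg.mpr (Real.exp_mul_two_sub_lt_two_add hx)))
    (pow_pos (hpos hx) 3)
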